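/- Let h, σ : ℝ → ℝ be continuous functions with σ(t) > 0 for all t. For real s ≤ t define a(s,t) = exp(∫_s^t h(τ) dτ) and b(s,t) = ∫_s^t σ(v)^2 · a(v,t)^2 dv, and for t ∈ [0,1] define κ(t) = b(0,t)·a(t,1)/b(0,1) and ν(t) = b(t,1)·a(0,t)/b(0,1). Then for every t ∈ (0,1): (i) a(0,1)·κ(t) + ν(t) = a(0,t), and (ii) a(0,1)·κ'(t) + ν'(t) = h(t)·(a(0,1)·κ(t) + ν(t)), where κ'(t) = σ(t)^2·a(t,1)/b(0,1) + κ(t)·h(t) and ν'(t) = ν(t)·(h(t) − σ(t)^2·a(t,1)^2/b(t,1)) are the derivatives of κ and ν at t. -/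

import Mathlib

/-- `a s t = exp (∫_s^t h τ dτ)`, the transition factor of the linear SDE. -/
noncomputable def aCoef (h : ℝ → ℝ) (s t : ℝ) : ℝ := Real.exp (∫ τ in s..t, h τ)

/-- `b s t = ∫_s^t σ(v)^2 a(v,t)^2 dv`, the accumulated variance. -/
noncomputable def bCoef (h σ : ℝ → ℝ) (s t : ℝ) : ℝ :=
  ∫ v in s..t, σ v ^ 2 * aCoef h v t ^ 2

/-- `κ t = b(0,t) a(t,1) / b(0,1)`, the `z₁`-coefficient of the interpolant. -/
noncomputable def kappaC (h σ : ℝ → ℝ) (t : ℝ) : ℝ :=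
  bCoef h σ 0 t * aCoef h t 1 / bCoef h σ 0 1

/-- `ν t = b(t,1) a(0,t) / b(0,1)`, the `z₀`-coefficient of the interpolant. -/
noncomputable def nuC (h σ : ℝ → ℝ) (t : ℝ) : ℝ :=
  bCoef h σ t 1 * aCoef h 0 t / bCoef h σ 0 1

/-- `η t = √(b(0,t) b(t,1) / b(0,1))`, the noise coefficient of the interpolant. -/
noncomputable def etaC (h σ : ℝ → ℝ) (t : ℝ) : ℝ :=
  Real.sqrt (bCoef h σ 0 t * bCoef h σ t 1 / bCoef h σ 0 1)

/-- `A t = exp (∫_0^t h)`. -/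
noncomputable def auxA (h : ℝ → ℝ) (t : ℝ) : ℝ := Real.exp (∫ τ in (0:ℝ)..t, h τ)

/-- `S t = ∫_0^t σ^2 / A^2`. -/
noncomputable def auxS (h σ : ℝ → ℝ) (t : ℝ) : ℝ := ∫ v in (0:ℝ)..t, σ v ^ 2 / auxA h v ^ 2

theorem auxA_pos (h : ℝ → ℝ) (t : ℝ) : 0 < auxA h t := Real.exp_pos _

theorem auxA_zero (h : ℝ → ℝ) : auxA h 0 = 1 := by simp [auxA]

theorem auxA_hasDerivAt (h : ℝ → ℝ) (hh : Continuous h) (t : ℝ) :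
    HasDerivAt (auxA h) (auxA h t * h t) t :=
  (intervalIntegral.integral_hasDerivAt_right (hh.intervalIntegrable _ _)
    (hh.stronglyMeasurableAtFilter _ _) hh.continuousAt).exp

theorem auxA_continuous (h : ℝ → ℝ) (hh : Continuous h) : Continuous (auxA h) :=
  continuous_iff_continuousAt.2 fun t => (auxA_hasDerivAt h hh t).continuousAt

theorem auxW_continuous (h σ : ℝ → ℝ) (hh : Continuous h) (hσ : Continuous σ) :
    Continuous (fun v => σ v ^ 2 / auxA h v ^ 2) :=
  (hσ.pow 2).div₀ ((auxA_continuous h hh).pow 2) fun v => (pow_pos (auxA_pos h v) 2).ne'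

theorem auxS_hasDerivAt (h σ : ℝ → ℝ) (hh : Continuous h) (hσ : Continuous σ) (t : ℝ) :
    HasDerivAt (auxS h σ) (σ t ^ 2 / auxA h t ^ 2) t :=
  have hc := auxW_continuous h σ hh hσ
  intervalIntegral.integral_hasDerivAt_right (hc.intervalIntegrable _ _)
    (hc.stronglyMeasurableAtFilter _ _) hc.continuousAt

theorem aCoef_eq (h : ℝ → ℝ) (hh : Continuous h) (s t : ℝ) :
    aCoef h s t = auxA h t / auxA h s := by
  unfold aCoef auxA
  rw [← Real.exp_sub, intervalIntegral.integral_interval_sub_left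
    (hh.intervalIntegrable _ _) (hh.intervalIntegrable _ _)]

theorem bCoef_eq (h σ : ℝ → ℝ) (hh : Continuous h) (hσ : Continuous σ) (s t : ℝ) :
    bCoef h σ s t = auxA h t ^ 2 * (auxS h σ t - auxS h σ s) := by
  have hc := auxW_continuous h σ hh hσ
  unfold bCoef auxS
  rw [intervalIntegral.integral_interval_sub_left
    (hc.intervalIntegrable _ _) (hc.intervalIntegrable _ _),
    ← intervalIntegral.integral_const_mul]
  congr 1
  ext v
  rw [aCoef_eq h hh]
  ring

theorem auxS_zero (h σ : ℝ → ℝ) : auxS h σ 0 = 0 := by simp [auxS]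

theorem auxS_lt (h σ : ℝ → ℝ) (hh : Continuous h) (hσ : Continuous σ)
    (hσpos : ∀ t, 0 < σ t) {s t : ℝ} (hst : s < t) : auxS h σ s < auxS h σ t := by
  have hc := auxW_continuous h σ hh hσ
  rw [← sub_pos]
  unfold auxS
  rw [intervalIntegral.integral_interval_sub_left
    (hc.intervalIntegrable _ _) (hc.intervalIntegrable _ _)]
  exact intervalIntegral.intervalIntegral_pos_of_pos (hc.intervalIntegrable _ _)
    (fun v => div_pos (pow_pos (hσpos v) 2) (pow_pos (auxA_pos h v) 2)) hst

theorem kappaC_eq (h σ : ℝ → ℝ) (hh : Continuous h) (hσ : Continuous σ) (t : ℝ) :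
    kappaC h σ t = auxA h t * auxS h σ t / (auxA h 1 * auxS h σ 1) := by
  have h1 := (auxA_pos h 1).ne'
  have h2 := (auxA_pos h t).ne'
  unfold kappaC
  rw [bCoef_eq h σ hh hσ, bCoef_eq h σ hh hσ, aCoef_eq h hh, auxS_zero, sub_zero, sub_zero]
  field_simp

theorem nuC_eq (h σ : ℝ → ℝ) (hh : Continuous h) (hσ : Continuous σ) (t : ℝ) :
    nuC h σ t = auxA h t * (auxS h σ 1 - auxS h σ t) / auxS h σ 1 := by
  have h1 := (auxA_pos h 1).ne'
  unfold nuC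
  rw [bCoef_eq h σ hh hσ, bCoef_eq h σ hh hσ, aCoef_eq h hh, auxS_zero, auxA_zero, sub_zero]
  field_simp

/-- The explicit derivative of `κ`. -/
theorem kappaC_hasDerivAt (h σ : ℝ → ℝ) (hh : Continuous h) (hσ : Continuous σ)
    (hσpos : ∀ t, 0 < σ t) (t : ℝ) :
    HasDerivAt (kappaC h σ)
      (σ t ^ 2 * aCoef h t 1 / bCoef h σ 0 1 + kappaC h σ t * h t) t := by
  have h1 := (auxA_pos h 1).ne'
  have h2 := (auxA_pos h t).ne'
  have h3 : auxS h σ 1 ≠ 0 := by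
    have := auxS_lt h σ hh hσ hσpos one_pos
    rw [auxS_zero] at this
    exact this.ne'
  have hd := ((auxA_hasDerivAt h hh t).mul (auxS_hasDerivAt h σ hh hσ t)).div_const
    (auxA h 1 * auxS h σ 1)
  rw [kappaC_eq h σ hh hσ, bCoef_eq h σ hh hσ, aCoef_eq h hh, auxS_zero, sub_zero,
    funext (kappaC_eq h σ hh hσ)]
  refine hd.congr_deriv ?_
  field_simp
  ring

/-- The explicit derivative of `ν` for `t < 1`. -/
theorem nuC_hasDerivAt (h σ : ℝ → ℝ) (hh : Continuous h) (hσ : Continuous σ)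
    (hσpos : ∀ t, 0 < σ t) (t : ℝ) (ht : t < 1) :
    HasDerivAt (nuC h σ)
      (nuC h σ t * (h t - σ t ^ 2 * aCoef h t 1 ^ 2 / bCoef h σ t 1)) t := by
  have h1 := (auxA_pos h 1).ne'
  have h2 := (auxA_pos h t).ne'
  have h3 : auxS h σ 1 ≠ 0 := by
    have := auxS_lt h σ hh hσ hσpos one_pos
    rw [auxS_zero] at this
    exact this.ne'
  have h4 : auxS h σ 1 - auxS h σ t ≠ 0 := (sub_pos.2 (auxS_lt h σ hh hσ hσpos ht)).ne'
  have hd := ((auxA_hasDerivAt h hh t).mul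
    ((auxS_hasDerivAt h σ hh hσ t).const_sub (auxS h σ 1))).div_const (auxS h σ 1)
  rw [nuC_eq h σ hh hσ, bCoef_eq h σ hh hσ, aCoef_eq h hh, funext (nuC_eq h σ hh hσ)]
  refine hd.congr_deriv ?_
  field_simp
  ring

/-- (i) `a(0,1) κ(t) + ν(t) = a(0,t)` and
(ii) `a(0,1) κ'(t) + ν'(t) = h(t) (a(0,1) κ(t) + ν(t))` on `(0,1)`. -/
theorem drift_from_kappa_nu (h σ : ℝ → ℝ) (hh : Continuous h) (hσ : Continuous σ)
    (hσpos : ∀ t, 0 < σ t) (t : ℝ) (ht : t ∈ Set.Ioo (0 : ℝ) 1) :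
    aCoef h 0 1 * kappaC h σ t + nuC h σ t = aCoef h 0 t ∧
    aCoef h 0 1 * deriv (kappaC h σ) t + deriv (nuC h σ) t =
      h t * (aCoef h 0 1 * kappaC h σ t + nuC h σ t) := by
  have h1 := (auxA_pos h 1).ne'
  have h2 := (auxA_pos h t).ne'
  have h3 : auxS h σ 1 ≠ 0 := by
    have := auxS_lt h σ hh hσ hσpos one_pos
    rw [auxS_zero] at this
    exact this.ne'
  have h4 : auxS h σ 1 - auxS h σ t ≠ 0 := (sub_pos.2 (auxS_lt h σ hh hσ hσpos ht.2)).ne'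
  constructor
  · rw [kappaC_eq h σ hh hσ, nuC_eq h σ hh hσ, aCoef_eq h hh, aCoef_eq h hh, auxA_zero]
    field_simp
    ring
  · rw [(kappaC_hasDerivAt h σ hh hσ hσpos t).deriv,
      (nuC_hasDerivAt h σ hh hσ hσpos t ht.2).deriv, kappaC_eq h σ hh hσ, nuC_eq h σ hh hσ,
      bCoef_eq h σ hh hσ, bCoef_eq h σ hh hσ, aCoef_eq h hh, aCoef_eq h hh, auxA_zero,
      auxS_zero, sub_zero]
    field_simp
    ring
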